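/- Let k be a division ring, let G be a locally indicable group, let N ⊴ G be a normal subgroup, and let t ∈ G be such that G/N is infinite cyclic generated by the coset tN. Let φ : kG → D be a Hughes-free embedding into a division ring D, let E be the division closure of φ(kN) in D, and let S be the subring of D generated by E ∪ {φ(t), φ(t)⁻¹}. Then: (a) the family (φ(t)^i)_{i∈ℤ} is a basis of S as a left E-module (so S is isomorphic to a twisted Laurent polynomial ring E[t^{±1}; τ], where τ is conjugation by φ(t)); and (b) every element of D can be written as a·b⁻¹ with a, b ∈ S and b ≠ 0, so that D is the Ore division ring of fractions of S; i.e. D ≅ Ore(E[t^{±1}; τ]) as kG-rings. -/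

import Mathlib

/-- A subring `S` of a ring `R` is a *division subring* if every nonzero element of `S`
has a two-sided inverse lying in `S`. -/
def IsDivisionSubring {R : Type*} [Ring R] (S : Subring R) : Prop :=
  ∀ x ∈ S, x ≠ 0 → ∃ y ∈ S, x * y = 1 ∧ y * x = 1

/-- The *division closure* of a subset `s` of a ring `R`: the smallest division subring
of `R` containing `s` (realized as the infimum of all division subrings containing `s`). -/
def divisionClosure {R : Type*} [Ring R] (s : Set R) : Subring R :=
  sInf {S : Subring R | IsDivisionSubring S ∧ s ⊆ S}

lemma subset_divisionClosure {R : Type*} [Ring R] (s : Set R) :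
    s ⊆ (divisionClosure s : Set R) := fun _x hx =>
  Subring.mem_sInf.2 fun _S hS => hS.2 hx

/-- Integer powers of an element of a ring, using `Ring.inverse` for negative exponents.
When the ambient ring is a division ring this agrees with the usual `zpow`. -/
noncomputable def ringZPow {R : Type*} [Ring R] (x : R) (i : ℤ) : R :=
  if 0 ≤ i then x ^ i.toNat else (Ring.inverse x) ^ (-i).toNat

/-- A group is *locally indicable* if every nontrivial finitely generated subgroup
admits a surjective homomorphism onto `ℤ`. -/
def LocallyIndicable (G : Type*) [Group G] : Prop :=
  ∀ H : Subgroup G, H ≠ ⊥ → H.FG →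
    ∃ f : H →* Multiplicative ℤ, Function.Surjective f

/-- `φ : kG →+* D` is a *Hughes-free embedding* if it is injective, the division closure
of its image is all of `D`, and whenever `H ≤ G` is finitely generated, `K ⊴ H` and
`t ∈ H` are such that `H/K` is infinite cyclic generated by `tK`, the integer powers of
`φ t` are left linearly independent over the division closure of `φ (kK)` in `D`. -/
def IsHughesFreeEmbedding {k : Type*} [DivisionRing k] {G : Type*} [Group G]
    {D : Type*} [Ring D] (φ : MonoidAlgebra k G →+* D) : Prop :=
  Function.Injective φ ∧
  divisionClosure (Set.range φ) = ⊤ ∧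
  ∀ (H : Subgroup G), H.FG → ∀ (K : Subgroup H) (t : H),
    (∃ f : H →* Multiplicative ℤ,
        Function.Surjective f ∧ f.ker = K ∧ f t = Multiplicative.ofAdd 1) →
    ∀ c : ℤ →₀ D,
      (∀ i : ℤ, c i ∈ divisionClosure
          (Set.range (φ.comp (MonoidAlgebra.mapDomainRingHom k (H.subtype.comp K.subtype))))) →
      (c.sum fun i a => a * ringZPow (φ (MonoidAlgebra.of k G (H.subtype t))) i) = 0 →
      c = 0

/-- A topological space is a *3-manifold* if it is nonempty, connected, Hausdorff,
second countable, and every point has an open neighbourhood homeomorphic to `ℝ³`. -/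
def Is3Manifold (M : Type*) [TopologicalSpace M] : Prop :=
  Nonempty M ∧ ConnectedSpace M ∧ T2Space M ∧ SecondCountableTopology M ∧
    ∀ x : M, ∃ U : Set M, IsOpen U ∧ x ∈ U ∧ Nonempty (U ≃ₜ (Fin 3 → ℝ))

section DivisionClosure

variable {D : Type*} [DivisionRing D]

lemma isDivisionSubring_iff_inv_mem {S : Subring D} :
    IsDivisionSubring S ↔ ∀ x ∈ S, x⁻¹ ∈ S := by
  refine ⟨fun h x hx => ?_, fun h x hx hx0 =>
    ⟨x⁻¹, h x hx, mul_inv_cancel₀ hx0, inv_mul_cancel₀ hx0⟩⟩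
  by_cases hx0 : x = 0
  · simp [hx0, S.zero_mem]
  · obtain ⟨y, hy, hxy, -⟩ := h x hx hx0
    rwa [inv_eq_of_mul_eq_one_right hxy]

lemma divisionClosure_le {s : Set D} {S : Subring D} (hS : ∀ x ∈ S, x⁻¹ ∈ S)
    (hs : s ⊆ S) : divisionClosure s ≤ S :=
  sInf_le ⟨isDivisionSubring_iff_inv_mem.2 hS, hs⟩

lemma inv_mem_divisionClosure {s : Set D} {x : D} (hx : x ∈ divisionClosure s) :
    x⁻¹ ∈ divisionClosure s :=
  Subring.mem_sInf.2 fun _ hS =>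
    isDivisionSubring_iff_inv_mem.1 hS.1 x (Subring.mem_sInf.1 hx _ hS)

lemma ringZPow_eq_zpow (x : D) (i : ℤ) : ringZPow x i = x ^ i := by
  unfold ringZPow
  split_ifs with h
  · rw [← zpow_natCast, Int.toNat_of_nonneg h]
  · rw [Ring.inverse_eq_inv', ← zpow_natCast, Int.toNat_of_nonneg (by omega), inv_zpow', neg_neg]

end DivisionClosure

section TwistedLaurent

variable {D : Type*} [DivisionRing D]

/-- The additive group of Laurent sums `∑ aᵢ uⁱ` with coefficients in `E`. -/
def laurentSums (E : Subring D) (u : D) : AddSubgroup D :=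
  AddSubgroup.closure {x | ∃ a ∈ E, ∃ i : ℤ, x = a * u ^ i}

/-- The additive group of polynomial sums `∑ aᵢ uⁱ`, `i < n`, with coefficients in `E`. -/
def polynomialSums (E : Subring D) (u : D) (n : ℕ) : AddSubgroup D :=
  AddSubgroup.closure {x | ∃ a ∈ E, ∃ i < n, x = a * u ^ i}

variable {E : Subring D} {u : D}

lemma mul_zpow_mem_laurentSums {a : D} (ha : a ∈ E) (i : ℤ) : a * u ^ i ∈ laurentSums E u :=
  AddSubgroup.subset_closure ⟨a, ha, i, rfl⟩

lemma exists_finsupp_of_mem_laurentSums {x : D} (hx : x ∈ laurentSums E u) :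
    ∃ c : ℤ →₀ D, (∀ i, c i ∈ E) ∧ x = c.sum fun i a => a * u ^ i := by
  classical
  induction hx using AddSubgroup.closure_induction with
  | mem x hx =>
    obtain ⟨a, ha, i, rfl⟩ := hx
    refine ⟨Finsupp.single i a, fun j => ?_, by simp⟩
    rw [Finsupp.single_apply]
    split_ifs
    exacts [ha, E.zero_mem]
  | zero => exact ⟨0, fun _ => E.zero_mem, by simp⟩
  | add x y _ _ hx hy =>
    obtain ⟨c, hc, rfl⟩ := hx
    obtain ⟨d, hd, rfl⟩ := hy
    exact ⟨c + d, fun i => E.add_mem (hc i) (hd i),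
      (Finsupp.sum_add_index' (by simp) (by simp [add_mul])).symm⟩
  | neg x _ hx =>
    obtain ⟨c, hc, rfl⟩ := hx
    refine ⟨-c, fun i => E.neg_mem (hc i), ?_⟩
    rw [Finsupp.sum_neg_index (by simp)]
    simp [Finsupp.sum]

lemma conj_zpow_mem (hu : u ≠ 0) (h₁ : ∀ x ∈ E, u * x * u⁻¹ ∈ E)
    (h₂ : ∀ x ∈ E, u⁻¹ * x * u ∈ E) (i : ℤ) : ∀ x ∈ E, u ^ i * x * (u ^ i)⁻¹ ∈ E := by
  induction i with
  | zero => simp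
  | succ n ih =>
    intro x hx
    have := ih _ (h₁ x hx)
    rw [zpow_add_one₀ hu, mul_inv_rev]
    simpa only [mul_assoc] using this
  | pred n ih =>
    intro x hx
    have := ih _ (h₂ x hx)
    rw [zpow_sub_one₀ hu, mul_inv_rev, inv_inv]
    simpa only [mul_assoc] using this

lemma mul_mem_laurentSums (hu : u ≠ 0) (hE : ∀ i : ℤ, ∀ x ∈ E, u ^ i * x * (u ^ i)⁻¹ ∈ E)
    {x y : D} (hx : x ∈ laurentSums E u) (hy : y ∈ laurentSums E u) :
    x * y ∈ laurentSums E u := by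
  induction hx using AddSubgroup.closure_induction with
  | zero => simp [zero_mem]
  | add x z _ _ hx hz => rw [add_mul]; exact add_mem hx hz
  | neg x _ hx => rw [neg_mul]; exact neg_mem hx
  | mem x hx =>
    obtain ⟨a, ha, i, rfl⟩ := hx
    induction hy using AddSubgroup.closure_induction with
    | zero => simp [zero_mem]
    | add x z _ _ hx hz => rw [mul_add]; exact add_mem hx hz
    | neg x _ hx => rw [mul_neg]; exact neg_mem hx
    | mem y hy =>
      obtain ⟨b, hb, j, rfl⟩ := hy
      have h : a * u ^ i * (b * u ^ j) = a * (u ^ i * b * (u ^ i)⁻¹) * u ^ (i + j) := by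
        rw [zpow_add₀ hu]
        simp only [mul_assoc, inv_mul_cancel_left₀ (zpow_ne_zero i hu)]
      rw [h]
      exact mul_zpow_mem_laurentSums (E.mul_mem ha (hE i b hb)) _

lemma closure_subset_laurentSums (hu : u ≠ 0)
    (hE : ∀ i : ℤ, ∀ x ∈ E, u ^ i * x * (u ^ i)⁻¹ ∈ E) {x : D}
    (hx : x ∈ Subring.closure ((E : Set D) ∪ {u, u⁻¹})) : x ∈ laurentSums E u := by
  induction hx using Subring.closure_induction with
  | mem x hx =>
    rcases hx with hx | rfl | rfl
    · simpa using mul_zpow_mem_laurentSums (u := u) hx 0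
    · simpa using mul_zpow_mem_laurentSums (u := x) E.one_mem 1
    · simpa using mul_zpow_mem_laurentSums (u := u) E.one_mem (-1)
  | zero => exact zero_mem _
  | one => simpa using mul_zpow_mem_laurentSums (u := u) E.one_mem 0
  | add x y _ _ hx hy => exact add_mem hx hy
  | neg x _ hx => exact neg_mem hx
  | mul x y _ _ hx hy => exact mul_mem_laurentSums hu hE hx hy

lemma zpow_mem_of_inv_mem {S : Subring D} (h : u ∈ S) (h' : u⁻¹ ∈ S) (i : ℤ) : u ^ i ∈ S := by
  cases i with
  | ofNat n => simpa using S.pow_mem h n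
  | negSucc n => rw [zpow_negSucc, ← inv_pow]; exact S.pow_mem h' _

lemma polynomialSums_mono {m n : ℕ} (h : m ≤ n) : polynomialSums E u m ≤ polynomialSums E u n :=
  AddSubgroup.closure_mono fun _ ⟨a, ha, i, hi, hx⟩ => ⟨a, ha, i, hi.trans_le h, hx⟩

lemma exists_mul_pow_mem_polynomialSums (hu : u ≠ 0) {x : D} (hx : x ∈ laurentSums E u) :
    ∃ N : ℕ, ∀ M ≥ N, ∃ n, x * u ^ M ∈ polynomialSums E u n := by
  induction hx using AddSubgroup.closure_induction with
  | zero => exact ⟨0, fun M _ => ⟨0, by simp [zero_mem]⟩⟩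
  | add x y _ _ hx hy =>
    obtain ⟨N₁, h₁⟩ := hx
    obtain ⟨N₂, h₂⟩ := hy
    refine ⟨max N₁ N₂, fun M hM => ?_⟩
    obtain ⟨n₁, k₁⟩ := h₁ M (le_of_max_le_left hM)
    obtain ⟨n₂, k₂⟩ := h₂ M (le_of_max_le_right hM)
    refine ⟨max n₁ n₂, ?_⟩
    rw [add_mul]
    exact add_mem (polynomialSums_mono (le_max_left _ _) k₁)
      (polynomialSums_mono (le_max_right _ _) k₂)
  | neg x _ hx =>
    obtain ⟨N, h⟩ := hx
    refine ⟨N, fun M hM => (h M hM).imp fun n hn => ?_⟩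
    rw [neg_mul]
    exact neg_mem hn
  | mem x hx =>
    obtain ⟨a, ha, i, rfl⟩ := hx
    refine ⟨i.natAbs, fun M hM => ⟨(i + M).toNat + 1, AddSubgroup.subset_closure
      ⟨a, ha, (i + M).toNat, by omega, ?_⟩⟩⟩
    rw [mul_assoc, ← zpow_natCast, ← zpow_natCast, ← zpow_add₀ hu,
      Int.toNat_of_nonneg (by omega)]

lemma exists_leadingTerm {n : ℕ} {x : D} (hx : x ∈ polynomialSums E u (n + 1)) :
    ∃ y ∈ polynomialSums E u n, ∃ a ∈ E, x = y + a * u ^ n := by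
  induction hx using AddSubgroup.closure_induction with
  | zero => exact ⟨0, zero_mem _, 0, E.zero_mem, by simp⟩
  | add x y _ _ hx hy =>
    obtain ⟨x, hx, a, ha, rfl⟩ := hx
    obtain ⟨y, hy, b, hb, rfl⟩ := hy
    exact ⟨x + y, add_mem hx hy, a + b, E.add_mem ha hb, by rw [add_mul]; abel⟩
  | neg x _ hx =>
    obtain ⟨x, hx, a, ha, rfl⟩ := hx
    exact ⟨-x, neg_mem hx, -a, E.neg_mem ha, by rw [neg_mul]; abel⟩
  | mem x hx =>
    obtain ⟨a, ha, i, hi, rfl⟩ := hx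
    rcases (Nat.lt_succ_iff_lt_or_eq.1 hi) with hi | rfl
    · exact ⟨_, AddSubgroup.subset_closure ⟨a, ha, i, hi, rfl⟩, 0, E.zero_mem, by simp⟩
    · exact ⟨0, zero_mem _, a, ha, by simp⟩

lemma mul_monomial_mem_polynomialSums (hu : u ≠ 0)
    (hE : ∀ i : ℤ, ∀ x ∈ E, u ^ i * x * (u ^ i)⁻¹ ∈ E) {n : ℕ} {x : D}
    (hx : x ∈ polynomialSums E u n) {b : D} (hb : b ∈ E) (j : ℕ) :
    x * (b * u ^ j) ∈ polynomialSums E u (n + j) := by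
  induction hx using AddSubgroup.closure_induction with
  | zero => simp [zero_mem]
  | add x z _ _ hx hz => rw [add_mul]; exact add_mem hx hz
  | neg x _ hx => rw [neg_mul]; exact neg_mem hx
  | mem x hx =>
    obtain ⟨a, ha, i, hi, rfl⟩ := hx
    have hb' : u ^ i * b * (u ^ i)⁻¹ ∈ E := by simpa using hE i b hb
    refine AddSubgroup.subset_closure ⟨_, E.mul_mem ha hb', i + j, by omega, ?_⟩
    rw [pow_add]
    simp only [mul_assoc, inv_mul_cancel_left₀ (pow_ne_zero i hu)]

lemma exists_sub_mul_mem_polynomialSums (hu : u ≠ 0) (hinv : ∀ x ∈ E, x⁻¹ ∈ E)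
    (hE : ∀ i : ℤ, ∀ x ∈ E, u ^ i * x * (u ^ i)⁻¹ ∈ E)
    {S : Subring D} (hES : E ≤ S) (huS : u ∈ S)
    {n : ℕ} {b₀ β : D} (hb₀ : b₀ ∈ polynomialSums E u n) (hβ : β ∈ E) (hβ0 : β ≠ 0) (m : ℕ) :
    ∀ a ∈ polynomialSums E u m, ∃ q ∈ S, a - (b₀ + β * u ^ n) * q ∈ polynomialSums E u n := by
  induction m with
  | zero =>
    intro a ha
    exact ⟨0, S.zero_mem, by simpa using polynomialSums_mono (Nat.zero_le n) ha⟩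
  | succ m ih =>
    intro a ha
    by_cases hmn : m + 1 ≤ n
    · exact ⟨0, S.zero_mem, by simpa using polynomialSums_mono hmn ha⟩
    obtain ⟨a₀, ha₀, α, hα, rfl⟩ := exists_leadingTerm ha
    obtain ⟨j, rfl⟩ : ∃ j, m = n + j := ⟨m - n, by omega⟩
    have hγ : (u ^ n)⁻¹ * (β⁻¹ * α) * u ^ n ∈ E := by
      simpa using hE (-n) _ (E.mul_mem (hinv β hβ) hα)
    set γ := (u ^ n)⁻¹ * (β⁻¹ * α) * u ^ n with hγdef
    have hlead : β * u ^ n * (γ * u ^ j) = α * u ^ (n + j) := by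
      rw [hγdef, pow_add]
      simp only [mul_assoc, mul_inv_cancel_left₀ (pow_ne_zero n hu), mul_inv_cancel_left₀ hβ0]
    obtain ⟨q, hq, hr⟩ := ih (a₀ - b₀ * (γ * u ^ j))
      (sub_mem ha₀ (mul_monomial_mem_polynomialSums hu hE hb₀ hγ j))
    refine ⟨γ * u ^ j + q, S.add_mem (S.mul_mem (hES hγ) (S.pow_mem huS j)) hq, ?_⟩
    convert hr using 1
    rw [mul_add, add_mul b₀ _ (γ * u ^ j), hlead]
    abel

lemma exists_right_common_multiple_of_mem_polynomialSums (hu : u ≠ 0) (hinv : ∀ x ∈ E, x⁻¹ ∈ E)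
    (hE : ∀ i : ℤ, ∀ x ∈ E, u ^ i * x * (u ^ i)⁻¹ ∈ E)
    {S : Subring D} (hES : E ≤ S) (huS : u ∈ S) (n : ℕ) :
    ∀ b ∈ polynomialSums E u n, b ≠ 0 → ∀ m, ∀ a ∈ polynomialSums E u m,
      ∃ c ∈ S, ∃ d ∈ S, d ≠ 0 ∧ a * d = b * c := by
  induction n with
  | zero =>
    intro b hb hb0
    simp [polynomialSums] at hb
    exact absurd hb hb0
  | succ n ih =>
    intro b hb hb0 m a ha
    obtain ⟨b₀, hb₀, β, hβ, rfl⟩ := exists_leadingTerm hb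
    by_cases hβ0 : β = 0
    · subst hβ0
      simp only [zero_mul, add_zero] at hb0 ⊢
      exact ih b₀ hb₀ hb0 m a ha
    obtain ⟨q, hq, hr⟩ :=
      exists_sub_mul_mem_polynomialSums hu hinv hE hES huS hb₀ hβ hβ0 m a ha
    set b := b₀ + β * u ^ n
    by_cases hr0 : a - b * q = 0
    · exact ⟨q, hq, 1, S.one_mem, one_ne_zero, by rw [mul_one, sub_eq_zero.1 hr0]⟩
    obtain ⟨c, hc, d, hd, hd0, h⟩ := ih _ hr hr0 _ b hb
    refine ⟨q * c + d, S.add_mem (S.mul_mem hq hc) hd, c, hc, ?_, ?_⟩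
    · rintro rfl
      rw [mul_zero] at h
      exact mul_ne_zero hb0 hd0 h
    · rw [mul_add, h]
      noncomm_ring

lemma exists_right_common_multiple (hu : u ≠ 0) (hinv : ∀ x ∈ E, x⁻¹ ∈ E)
    (hE : ∀ i : ℤ, ∀ x ∈ E, u ^ i * x * (u ^ i)⁻¹ ∈ E) {a b : D}
    (ha : a ∈ Subring.closure ((E : Set D) ∪ {u, u⁻¹}))
    (hb : b ∈ Subring.closure ((E : Set D) ∪ {u, u⁻¹})) (hb0 : b ≠ 0) :
    ∃ c ∈ Subring.closure ((E : Set D) ∪ {u, u⁻¹}),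
      ∃ d ∈ Subring.closure ((E : Set D) ∪ {u, u⁻¹}), d ≠ 0 ∧ a * d = b * c := by
  have hES : E ≤ Subring.closure ((E : Set D) ∪ {u, u⁻¹}) := fun x hx =>
    Subring.subset_closure (Or.inl hx)
  have huS : u ∈ Subring.closure ((E : Set D) ∪ {u, u⁻¹}) :=
    Subring.subset_closure (Or.inr (Or.inl rfl))
  obtain ⟨N₁, h₁⟩ :=
    exists_mul_pow_mem_polynomialSums hu (closure_subset_laurentSums hu hE ha)
  obtain ⟨N₂, h₂⟩ :=
    exists_mul_pow_mem_polynomialSums hu (closure_subset_laurentSums hu hE hb)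
  obtain ⟨m, hm⟩ := h₁ N₁ le_rfl
  obtain ⟨n, hn⟩ := h₂ N₂ le_rfl
  obtain ⟨c, hc, d, hd, hd0, h⟩ := exists_right_common_multiple_of_mem_polynomialSums
    hu hinv hE hES huS n _ hn (mul_ne_zero hb0 (pow_ne_zero _ hu)) m _ hm
  exact ⟨u ^ N₂ * c, mul_mem (pow_mem huS _) hc, u ^ N₁ * d, mul_mem (pow_mem huS _) hd,
    mul_ne_zero (pow_ne_zero _ hu) hd0, by simpa only [mul_assoc] using h⟩

/-- The right fractions of a subring satisfying the right Ore condition form a subring. -/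
def rightFractions (S : Subring D)
    (hS : ∀ a ∈ S, ∀ b ∈ S, b ≠ 0 → ∃ c ∈ S, ∃ d ∈ S, d ≠ 0 ∧ a * d = b * c) : Subring D where
  carrier := {x | ∃ a ∈ S, ∃ b ∈ S, b ≠ 0 ∧ x = a * b⁻¹}
  one_mem' := ⟨1, S.one_mem, 1, S.one_mem, one_ne_zero, by simp⟩
  zero_mem' := ⟨0, S.zero_mem, 1, S.one_mem, one_ne_zero, by simp⟩
  neg_mem' := by
    rintro _ ⟨a, ha, b, hb, hb0, rfl⟩
    exact ⟨-a, S.neg_mem ha, b, hb, hb0, by simp⟩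
  mul_mem' := by
    rintro _ _ ⟨a, ha, b, hb, hb0, rfl⟩ ⟨c, hc, d, hd, hd0, rfl⟩
    obtain ⟨p, hp, q, hq, hq0, h⟩ := hS c hc b hb hb0
    refine ⟨a * p, S.mul_mem ha hp, d * q, S.mul_mem hd hq, mul_ne_zero hd0 hq0, ?_⟩
    have hp' : p = b⁻¹ * (c * q) := by rw [h, inv_mul_cancel_left₀ hb0]
    rw [hp', mul_inv_rev]
    simp only [mul_assoc, mul_inv_cancel_left₀ hq0]
  add_mem' := by
    rintro _ _ ⟨a, ha, b, hb, hb0, rfl⟩ ⟨c, hc, d, hd, hd0, rfl⟩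
    obtain ⟨p, hp, q, hq, hq0, h⟩ := hS b hb d hd hd0
    have hp0 : p ≠ 0 := by
      rintro rfl
      rw [mul_zero] at h
      exact mul_ne_zero hb0 hq0 h
    refine ⟨a * q + c * p, S.add_mem (S.mul_mem ha hq) (S.mul_mem hc hp), b * q,
      S.mul_mem hb hq, mul_ne_zero hb0 hq0, ?_⟩
    rw [add_mul]
    congr 1
    · rw [mul_inv_rev, mul_assoc, mul_inv_cancel_left₀ hq0]
    · rw [h, mul_inv_rev, mul_assoc, mul_inv_cancel_left₀ hp0]

lemma inv_mem_rightFractions {S : Subring D}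
    {hS : ∀ a ∈ S, ∀ b ∈ S, b ≠ 0 → ∃ c ∈ S, ∃ d ∈ S, d ≠ 0 ∧ a * d = b * c} {x : D}
    (hx : x ∈ rightFractions S hS) : x⁻¹ ∈ rightFractions S hS := by
  by_cases hx0 : x = 0
  · simp [hx0, zero_mem]
  obtain ⟨a, ha, b, hb, hb0, rfl⟩ := hx
  exact ⟨b, hb, a, ha, left_ne_zero_of_mul hx0, by simp⟩

end TwistedLaurent

section GroupAlgebra

variable {k : Type*} [DivisionRing k] {G : Type*} [Group G] {D : Type*} [DivisionRing D]

/-- The division closure in `D` of the image of the group algebra of a subgroup. -/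
abbrev subgroupDivisionClosure (φ : MonoidAlgebra k G →+* D) (M : Subgroup G) : Subring D :=
  divisionClosure (Set.range (φ.comp (MonoidAlgebra.mapDomainRingHom k M.subtype)))

variable {φ : MonoidAlgebra k G →+* D}

lemma range_comp_mapDomainRingHom_subset {H : Type*} [Group H] {f : H →* G} {S : Subring D}
    (h : ∀ g a, φ (MonoidAlgebra.single (f g) a) ∈ S) :
    Set.range (φ.comp (MonoidAlgebra.mapDomainRingHom k f)) ⊆ S := by
  rintro _ ⟨x, rfl⟩
  induction x using MonoidAlgebra.induction_linear with
  | zero => simp [S.zero_mem]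
  | add x y hx hy => rw [map_add]; exact S.add_mem hx hy
  | single g a => simpa using h g a

lemma single_mem_subgroupDivisionClosure {M : Subgroup G} {g : G} (hg : g ∈ M) (a : k) :
    φ (MonoidAlgebra.single g a) ∈ subgroupDivisionClosure φ M :=
  subset_divisionClosure _ ⟨MonoidAlgebra.single ⟨g, hg⟩ a, by simp⟩

lemma subgroupDivisionClosure_le {M : Subgroup G} {S : Subring D} (hS : ∀ x ∈ S, x⁻¹ ∈ S)
    (h : ∀ g ∈ M, ∀ a, φ (MonoidAlgebra.single g a) ∈ S) : subgroupDivisionClosure φ M ≤ S :=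
  divisionClosure_le hS (range_comp_mapDomainRingHom_subset fun g a => h g g.2 a)

lemma subgroupDivisionClosure_mono {M M' : Subgroup G} (h : M ≤ M') :
    subgroupDivisionClosure φ M ≤ subgroupDivisionClosure φ M' :=
  subgroupDivisionClosure_le (fun _ => inv_mem_divisionClosure)
    fun _ hg => single_mem_subgroupDivisionClosure (h hg)

lemma exists_fg_mem_subgroupDivisionClosure {N : Subgroup G} {x : D}
    (hx : x ∈ subgroupDivisionClosure φ N) :
    ∃ M ≤ N, M.FG ∧ x ∈ subgroupDivisionClosure φ M := by
  let U : Subring D :=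
    { carrier := {x | ∃ M ≤ N, M.FG ∧ x ∈ subgroupDivisionClosure φ M}
      one_mem' := ⟨⊥, bot_le, Subgroup.FG.bot, one_mem _⟩
      zero_mem' := ⟨⊥, bot_le, Subgroup.FG.bot, zero_mem _⟩
      neg_mem' := by
        rintro _ ⟨M, hM, hfg, hx⟩
        exact ⟨M, hM, hfg, neg_mem hx⟩
      mul_mem' := by
        rintro _ _ ⟨M, hM, hfg, hx⟩ ⟨M', hM', hfg', hx'⟩
        exact ⟨M ⊔ M', sup_le hM hM', hfg.sup hfg',
          mul_mem (subgroupDivisionClosure_mono le_sup_left hx)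
            (subgroupDivisionClosure_mono le_sup_right hx')⟩
      add_mem' := by
        rintro _ _ ⟨M, hM, hfg, hx⟩ ⟨M', hM', hfg', hx'⟩
        exact ⟨M ⊔ M', sup_le hM hM', hfg.sup hfg',
          add_mem (subgroupDivisionClosure_mono le_sup_left hx)
            (subgroupDivisionClosure_mono le_sup_right hx')⟩ }
  have hU : subgroupDivisionClosure φ N ≤ U := by
    refine subgroupDivisionClosure_le ?_ fun g hg a => ?_
    · rintro _ ⟨M, hM, hfg, hx⟩
      exact ⟨M, hM, hfg, inv_mem_divisionClosure hx⟩
    · exact ⟨Subgroup.zpowers g, by simpa using hg, ⟨{g}, by simp [Subgroup.zpowers_eq_closure]⟩,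
        single_mem_subgroupDivisionClosure (Subgroup.mem_zpowers g) a⟩
  exact hU hx

lemma exists_fg_forall_mem_subgroupDivisionClosure {N : Subgroup G} {c : ℤ →₀ D}
    (hc : ∀ i, c i ∈ subgroupDivisionClosure φ N) :
    ∃ M ≤ N, M.FG ∧ ∀ i, c i ∈ subgroupDivisionClosure φ M := by
  choose M hMN hfg hM using fun i => exists_fg_mem_subgroupDivisionClosure (hc i)
  refine ⟨⨆ i ∈ c.support, M i, iSup₂_le fun i _ => hMN i,
    Subgroup.FG.biSup_finset _ _ fun i _ => hfg i, fun i => ?_⟩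
  by_cases hi : i ∈ c.support
  · exact subgroupDivisionClosure_mono (le_iSup₂_of_le i hi le_rfl) (hM i)
  · rw [Finsupp.notMem_support_iff.1 hi]
    exact zero_mem _

lemma map_of_ne_zero (g : G) : φ (MonoidAlgebra.of k G g) ≠ 0 :=
  ((Group.isUnit g).map (φ.toMonoidHom.comp (MonoidAlgebra.of k G))).ne_zero

lemma map_of_inv (g : G) : φ (MonoidAlgebra.of k G g⁻¹) = (φ (MonoidAlgebra.of k G g))⁻¹ := by
  refine (inv_eq_of_mul_eq_one_right ?_).symm
  rw [← map_mul, ← map_mul, mul_inv_cancel, map_one, map_one]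

lemma map_of_zpow (g : G) (i : ℤ) :
    φ (MonoidAlgebra.of k G (g ^ i)) = φ (MonoidAlgebra.of k G g) ^ i := by
  cases i with
  | ofNat n => rw [Int.ofNat_eq_natCast, zpow_natCast, zpow_natCast, map_pow, map_pow]
  | negSucc n => rw [zpow_negSucc, zpow_negSucc, map_of_inv, map_pow, map_pow]

lemma conj_mem_subgroupDivisionClosure {N : Subgroup G} (hN : N.Normal) (t : G) {x : D}
    (hx : x ∈ subgroupDivisionClosure φ N) :
    φ (MonoidAlgebra.of k G t) * x * (φ (MonoidAlgebra.of k G t))⁻¹ ∈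
      subgroupDivisionClosure φ N := by
  have hu : φ (MonoidAlgebra.of k G t) ≠ 0 := map_of_ne_zero t
  let conj : D →+* D :=
    { toFun := fun x => φ (MonoidAlgebra.of k G t) * x * (φ (MonoidAlgebra.of k G t))⁻¹
      map_one' := by simp [-MonoidAlgebra.of_apply, hu]
      map_zero' := by simp
      map_mul' := fun x y => by simp only [mul_assoc, inv_mul_cancel_left₀ hu]
      map_add' := fun x y => by rw [mul_add, add_mul] }
  have h : subgroupDivisionClosure φ N ≤ (subgroupDivisionClosure φ N).comap conj := by
    refine subgroupDivisionClosure_le (fun x hx => ?_) fun g hg a => ?_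
    · rw [Subring.mem_comap] at hx ⊢
      rw [map_inv₀]
      exact inv_mem_divisionClosure hx
    · have key : conj (φ (MonoidAlgebra.single g a)) =
          φ (MonoidAlgebra.single (t * g * t⁻¹) a) := by
        change φ (MonoidAlgebra.of k G t) * _ * (φ (MonoidAlgebra.of k G t))⁻¹ = _
        rw [← map_of_inv, ← map_mul, ← map_mul]
        simp
      rw [Subring.mem_comap, key]
      exact single_mem_subgroupDivisionClosure (hN.conj_mem g hg t) a
  exact h hx

lemma IsHughesFreeEmbedding.zpow_linearIndependent (hφ : IsHughesFreeEmbedding φ)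
    {f : G →* Multiplicative ℤ} {t : G} (ht : f t = Multiplicative.ofAdd 1) {c : ℤ →₀ D}
    (hc : ∀ i, c i ∈ subgroupDivisionClosure φ f.ker)
    (hsum : (c.sum fun i a => a * φ (MonoidAlgebra.of k G t) ^ i) = 0) : c = 0 := by
  obtain ⟨M, hM, hfg, hcM⟩ := exists_fg_forall_mem_subgroupDivisionClosure hc
  have hMH : M ≤ M ⊔ Subgroup.zpowers t := le_sup_left
  have htH : t ∈ M ⊔ Subgroup.zpowers t :=
    (le_sup_right : _ ≤ M ⊔ Subgroup.zpowers t) (Subgroup.mem_zpowers t)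
  refine hφ.2.2 (M ⊔ Subgroup.zpowers t)
    (hfg.sup ⟨{t}, by simp [Subgroup.zpowers_eq_closure]⟩)
    (f.comp (M ⊔ Subgroup.zpowers t).subtype).ker ⟨t, htH⟩
    ⟨f.comp (M ⊔ Subgroup.zpowers t).subtype, fun n => ?_, rfl, ht⟩ c (fun i => ?_) ?_
  · refine ⟨⟨t, htH⟩ ^ (Multiplicative.toAdd n), ?_⟩
    rw [map_zpow]
    change f t ^ _ = _
    rw [ht, ← ofAdd_zsmul]
    simp
  · refine subgroupDivisionClosure_le (fun _ => inv_mem_divisionClosure) (fun g hg a => ?_) (hcM i)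
    exact subset_divisionClosure _
      ⟨MonoidAlgebra.single ⟨⟨g, hMH hg⟩, hM hg⟩ a, by simp⟩
  · simp only [ringZPow_eq_zpow]
    exact hsum

end GroupAlgebra

/-- Let `G` be locally indicable, `N ⊴ G` with `G/N` infinite cyclic generated by `tN`,
and let `φ : kG → D` be a Hughes-free embedding.  Let `E` be the division closure of
`φ(kN)` in `D` and let `S` be the subring of `D` generated by `E ∪ {φ t, (φ t)⁻¹}`.
Then (a) the integer powers of `φ t` form a basis of `S` as a left `E`-module (so `S` is
a twisted Laurent polynomial ring `E[t^{±1}; τ]`), and (b) every element of `D` has the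
form `a * b⁻¹` with `a, b ∈ S`, `b ≠ 0`; i.e. `D` is the Ore division ring of fractions
of `S`. -/
theorem hughesFree_of_infiniteCyclic_quotient_is_ore
    {k : Type u} [DivisionRing k] {G : Type v} [Group G]
    (hG : LocallyIndicable G)
    (N : Subgroup G) (hN : N.Normal) (t : G)
    (hcyc : ∃ f : G →* Multiplicative ℤ,
      Function.Surjective f ∧ f.ker = N ∧ f t = Multiplicative.ofAdd 1)
    {D : Type w} [DivisionRing D] (φ : MonoidAlgebra k G →+* D)
    (hφ : IsHughesFreeEmbedding φ) :
    ∀ (E : Subring D), E = divisionClosure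
        (Set.range (φ.comp (MonoidAlgebra.mapDomainRingHom k N.subtype))) →
    ∀ (S : Subring D), S = Subring.closure
        ((E : Set D) ∪ {φ (MonoidAlgebra.of k G t), (φ (MonoidAlgebra.of k G t))⁻¹}) →
      ((∀ c : ℤ →₀ D, (∀ i : ℤ, c i ∈ E) →
          (c.sum fun i a => a * φ (MonoidAlgebra.of k G t) ^ i) = 0 → c = 0) ∧
        (∀ s ∈ S, ∃ c : ℤ →₀ D, (∀ i : ℤ, c i ∈ E) ∧
          s = c.sum fun i a => a * φ (MonoidAlgebra.of k G t) ^ i)) ∧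
      (∀ d : D, ∃ a ∈ S, ∃ b ∈ S, b ≠ 0 ∧ d = a * b⁻¹) := by
  rintro E rfl S rfl
  obtain ⟨f, -, rfl, ht⟩ := hcyc
  set u : D := φ (MonoidAlgebra.of k G t) with hudef
  have hu : u ≠ 0 := map_of_ne_zero t
  have hinv : ∀ x ∈ subgroupDivisionClosure φ f.ker, x⁻¹ ∈ subgroupDivisionClosure φ f.ker :=
    fun _ => inv_mem_divisionClosure
  have hE : ∀ i : ℤ, ∀ x ∈ subgroupDivisionClosure φ f.ker,
      u ^ i * x * (u ^ i)⁻¹ ∈ subgroupDivisionClosure φ f.ker := fun i x hx => by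
    rw [hudef, ← map_of_zpow]
    exact conj_mem_subgroupDivisionClosure hN _ hx
  refine ⟨⟨fun c hc hsum => hφ.zpow_linearIndependent ht hc hsum, fun s hs =>
    exists_finsupp_of_mem_laurentSums (closure_subset_laurentSums hu hE hs)⟩, fun d => ?_⟩
  set S := Subring.closure ((subgroupDivisionClosure φ f.ker : Set D) ∪ {u, u⁻¹})
  have huS : u ∈ S := Subring.subset_closure (Or.inr (Or.inl rfl))
  have huS' : u⁻¹ ∈ S := Subring.subset_closure (Or.inr (Or.inr rfl))
  have hore : ∀ a ∈ S, ∀ b ∈ S, b ≠ 0 → ∃ c ∈ S, ∃ d ∈ S, d ≠ 0 ∧ a * d = b * c :=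
    fun a ha b hb hb0 => exists_right_common_multiple hu hinv hE ha hb hb0
  have hrange : Set.range φ ⊆ rightFractions S hore := by
    rintro _ ⟨x, rfl⟩
    induction x using MonoidAlgebra.induction_linear with
    | zero => simp [zero_mem]
    | add x y hx hy => rw [map_add]; exact add_mem hx hy
    | single g a =>
      have hg : g * (t ^ Multiplicative.toAdd (f g))⁻¹ ∈ f.ker := by
        rw [MonoidHom.mem_ker, map_mul, map_inv, map_zpow, ht, ← ofAdd_zsmul]
        simp
      have hmul : φ (MonoidAlgebra.single g a) =
          φ (MonoidAlgebra.single (g * (t ^ Multiplicative.toAdd (f g))⁻¹) a) *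
            u ^ Multiplicative.toAdd (f g) := by
        rw [hudef, ← map_of_zpow, ← map_mul]
        simp
      refine ⟨_, ?_, 1, S.one_mem, one_ne_zero, by rw [inv_one, mul_one]⟩
      rw [hmul]
      exact S.mul_mem
        (Subring.subset_closure (Or.inl (single_mem_subgroupDivisionClosure hg a)))
        (zpow_mem_of_inv_mem huS huS' _)
  have htop : divisionClosure (Set.range φ) ≤ rightFractions S hore :=
    divisionClosure_le (fun _ => inv_mem_rightFractions) hrange
  rw [hφ.2.1] at htop
  exact htop (Subring.mem_top d)
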